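/- arXiv:1109.3160 — 5 statements merged into one kernel-verified Lean document; each statement's English description precedes it below -/
import Mathlib

section
/- Let Σm be a K×K real symmetric positive definite matrix and let Σc be a K×K real symmetric matrix. Then the two-vector canonical correlation supremum equals the one-vector supremum; that is, sup over nonzero w_i, w_j ∈ ℝ^K of |w_iᵀ Σc w_j| / (√(w_iᵀ Σm w_i) · √(w_jᵀ Σm w_j)) equals sup over nonzero w ∈ ℝ^K of |wᵀ Σc w| / (wᵀ Σm w). (Proposition 1, homogeneity reduction: under equal marginal correlation matrices and a symmetric cross-correlation matrix, only one set of canonical weights is needed.) -/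
open Matrix

/-- Polarization bound. -/
theorem polar_aux (K : ℕ) (Sm Sc : Matrix (Fin K) (Fin K) ℝ)
    (hm : Sm.IsSymm) (hc : Sc.IsSymm) (M : ℝ)
    (h : ∀ w : Fin K → ℝ, |w ⬝ᵥ (Sc *ᵥ w)| ≤ M * (w ⬝ᵥ (Sm *ᵥ w)))
    (u v : Fin K → ℝ) (a b : ℝ) (ha : 0 < a) (hb : 0 < b)
    (hu : u ⬝ᵥ (Sm *ᵥ u) = a ^ 2) (hv : v ⬝ᵥ (Sm *ᵥ v) = b ^ 2) :
    |u ⬝ᵥ (Sc *ᵥ v)| ≤ M * (a * b) := by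
  have sw : ∀ S : Matrix (Fin K) (Fin K) ℝ, S.IsSymm →
      v ⬝ᵥ (S *ᵥ u) = u ⬝ᵥ (S *ᵥ v) := by
    intro S hS
    rw [Matrix.dotProduct_mulVec, ← Matrix.mulVec_transpose, hS.eq, dotProduct_comm]
  have ex : ∀ (S : Matrix (Fin K) (Fin K) ℝ), S.IsSymm → ∀ s : ℝ,
      (b • u + s • v) ⬝ᵥ (S *ᵥ (b • u + s • v)) =
      b ^ 2 * (u ⬝ᵥ (S *ᵥ u)) + 2 * (b * s) * (u ⬝ᵥ (S *ᵥ v)) + s ^ 2 * (v ⬝ᵥ (S *ᵥ v)) := by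
    intro S hS s
    simp only [Matrix.mulVec_add, Matrix.mulVec_smul, dotProduct_add, add_dotProduct,
      dotProduct_smul, smul_dotProduct, smul_eq_mul, sw S hS]
    ring
  have h1 := h (b • u + a • v)
  have h2 := h (b • u + (-a) • v)
  rw [ex Sc hc, ex Sm hm, hu, hv, abs_le] at h1 h2
  have hab : 0 < 4 * (a * b) := by positivity
  rw [abs_le]
  constructor
  · refine le_of_mul_le_mul_left ?_ hab
    nlinarith [h1.1, h2.2]
  · refine le_of_mul_le_mul_left ?_ hab
    nlinarith [h1.2, h2.1]

theorem sSup_eq_aux (A B : Set ℝ) (hBA : B ⊆ A) (hne : A.Nonempty → B.Nonempty)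
    (h : ∀ M ∈ upperBounds B, M ∈ upperBounds A) : sSup A = sSup B := by
  rcases A.eq_empty_or_nonempty with hA | hA
  · have : B = ∅ := Set.subset_empty_iff.1 (hA ▸ hBA)
    rw [hA, this]
  have hB := hne hA
  by_cases hb : BddAbove B
  · have l := isLUB_csSup hB hb
    exact IsLUB.csSup_eq ⟨h _ l.1, fun M hM => l.2 fun x hx => hM (hBA hx)⟩ hA
  · have ha : ¬ BddAbove A := fun h' => hb (h'.mono hBA)
    rw [Real.sSup_of_not_bddAbove ha, Real.sSup_of_not_bddAbove hb]

/-- Proposition 1 (homogeneity reduction): for a symmetric positive definite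
marginal matrix `Sm` and a symmetric cross matrix `Sc`, the two-vector
canonical correlation supremum equals the one-vector supremum. -/
theorem stmt_0 (K : ℕ) (Sm Sc : Matrix (Fin K) (Fin K) ℝ)
    (hm : Sm.PosDef) (hc : Sc.IsSymm) :
    sSup {x : ℝ | ∃ wi wj : Fin K → ℝ, wi ≠ 0 ∧ wj ≠ 0 ∧
        x = |wi ⬝ᵥ (Sc *ᵥ wj)| /
          (Real.sqrt (wi ⬝ᵥ (Sm *ᵥ wi)) * Real.sqrt (wj ⬝ᵥ (Sm *ᵥ wj)))} =
    sSup {x : ℝ | ∃ w : Fin K → ℝ, w ≠ 0 ∧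
        x = |w ⬝ᵥ (Sc *ᵥ w)| / (w ⬝ᵥ (Sm *ᵥ w))} := by
  have pos : ∀ w : Fin K → ℝ, w ≠ 0 → 0 < w ⬝ᵥ (Sm *ᵥ w) := by
    intro w hw
    simpa using hm.dotProduct_mulVec_pos hw
  have hs : Sm.IsSymm := by
    have := hm.isHermitian.eq
    rwa [Matrix.conjTranspose_eq_transpose_of_trivial] at this
  apply sSup_eq_aux
  · rintro x ⟨w, hw, rfl⟩
    exact ⟨w, w, hw, hw, by rw [Real.mul_self_sqrt (pos w hw).le]⟩
  · rintro ⟨x, w, _, hw, _, _⟩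
    exact ⟨_, w, hw, rfl⟩
  · rintro M hM x ⟨u, v, hu, hv, rfl⟩
    have pu := Real.sqrt_pos.2 (pos u hu)
    have pv := Real.sqrt_pos.2 (pos v hv)
    rw [div_le_iff₀ (mul_pos pu pv)]
    refine polar_aux K Sm Sc hs hc M ?_ u v _ _ pu pv
      (Real.sq_sqrt (pos u hu).le).symm (Real.sq_sqrt (pos v hv).le).symm
    intro w
    by_cases hw : w = 0
    · simp [hw]
    · rw [← div_le_iff₀ (pos w hw)]
      exact hM ⟨w, hw, rfl⟩
end

section
/- Let r, b, ρ1, ρ2 be real numbers, Σm = [[1, r],[r, 1]], Σc = [[ρ1, b],[b, ρ2]], and let Σ be the 4×4 block matrix [[Σm, Σc],[Σc, Σm]]. Then the eigenvalues of Σ (with multiplicity) are exactly the four real numbers: 1 − ((ρ1 + ρ2) + √((ρ1 − ρ2)² + 4(b − r)²))/2, 1 − ((ρ1 + ρ2) − √((ρ1 − ρ2)² + 4(b − r)²))/2, 1 + ((ρ1 + ρ2) + √((ρ1 − ρ2)² + 4(b + r)²))/2, and 1 + ((ρ1 + ρ2) − √((ρ1 − ρ2)² + 4(b + r)²))/2.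 -/
open Matrix

/-- Eigenvalues (with multiplicity) of the 4×4 supermatrix
`Σ = [[Σm, Σc],[Σc, Σm]]` with `Σm = [[1,r],[r,1]]`, `Σc = [[ρ1,b],[b,ρ2]]`. -/
theorem stmt_5 (r b ρ1 ρ2 : ℝ) :
    (Matrix.fromBlocks (!![1, r; r, 1]) (!![ρ1, b; b, ρ2])
        (!![ρ1, b; b, ρ2]) (!![1, r; r, 1])).charpoly.roots =
      {1 - ((ρ1 + ρ2) + Real.sqrt ((ρ1 - ρ2) ^ 2 + 4 * (b - r) ^ 2)) / 2,
       1 - ((ρ1 + ρ2) - Real.sqrt ((ρ1 - ρ2) ^ 2 + 4 * (b - r) ^ 2)) / 2,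
       1 + ((ρ1 + ρ2) + Real.sqrt ((ρ1 - ρ2) ^ 2 + 4 * (b + r) ^ 2)) / 2,
       1 + ((ρ1 + ρ2) - Real.sqrt ((ρ1 - ρ2) ^ 2 + 4 * (b + r) ^ 2)) / 2} := by
  have hs := Real.sq_sqrt (show 0 ≤ (ρ1 - ρ2) ^ 2 + 4 * (b - r) ^ 2 by positivity)
  have ht := Real.sq_sqrt (show 0 ≤ (ρ1 - ρ2) ^ 2 + 4 * (b + r) ^ 2 by positivity)
  generalize Real.sqrt ((ρ1 - ρ2) ^ 2 + 4 * (b - r) ^ 2) = s at *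
  generalize Real.sqrt ((ρ1 - ρ2) ^ 2 + 4 * (b + r) ^ 2) = t at *
  rw [← Polynomial.roots_multiset_prod_X_sub_C {1 - ((ρ1 + ρ2) + s) / 2,
    1 - ((ρ1 + ρ2) - s) / 2, 1 + ((ρ1 + ρ2) + t) / 2, 1 + ((ρ1 + ρ2) - t) / 2}]
  congr 1
  apply Polynomial.funext
  intro x
  have h1 : (x - (1 - ((ρ1 + ρ2) + s) / 2)) * (x - (1 - ((ρ1 + ρ2) - s) / 2)) =
      (x - 1 + ρ1) * (x - 1 + ρ2) - (b - r) ^ 2 := by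
    linear_combination (-1 / 4) * hs
  have h2 : (x - (1 + ((ρ1 + ρ2) + t) / 2)) * (x - (1 + ((ρ1 + ρ2) - t) / 2)) =
      (x - 1 - ρ1) * (x - 1 - ρ2) - (b + r) ^ 2 := by
    linear_combination (-1 / 4) * ht
  have hR : Polynomial.eval x (Multiset.map (fun a => Polynomial.X - Polynomial.C a)
      ({1 - ((ρ1 + ρ2) + s) / 2, 1 - ((ρ1 + ρ2) - s) / 2, 1 + ((ρ1 + ρ2) + t) / 2,
        1 + ((ρ1 + ρ2) - t) / 2} : Multiset ℝ)).prod =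
      ((x - (1 - ((ρ1 + ρ2) + s) / 2)) * (x - (1 - ((ρ1 + ρ2) - s) / 2))) *
      ((x - (1 + ((ρ1 + ρ2) + t) / 2)) * (x - (1 + ((ρ1 + ρ2) - t) / 2))) := by
    simp only [Multiset.insert_eq_cons, Multiset.map_cons, Multiset.prod_cons,
      Multiset.map_singleton, Multiset.prod_singleton, Polynomial.eval_mul,
      Polynomial.eval_sub, Polynomial.eval_X, Polynomial.eval_C]
    ring
  rw [hR, h1, h2, Matrix.eval_charpoly]
  have hM : (Matrix.scalar (Fin 2 ⊕ Fin 2) x - Matrix.fromBlocks (!![1, r; r, 1])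
      (!![ρ1, b; b, ρ2]) (!![ρ1, b; b, ρ2]) (!![1, r; r, 1])) =
      (!![x - 1, -r, -ρ1, -b; -r, x - 1, -b, -ρ2; -ρ1, -b, x - 1, -r;
        -b, -ρ2, -r, x - 1]).submatrix (finSumFinEquiv (m := 2) (n := 2))
        (finSumFinEquiv (m := 2) (n := 2)) := by
    ext i j
    rcases i with i | i <;> rcases j with j | j <;> fin_cases i <;> fin_cases j <;>
      simp [Matrix.scalar_apply, finSumFinEquiv, Fin.natAdd, Fin.castAdd, Fin.castLE]
  rw [hM, Matrix.det_submatrix_equiv_self]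
  simp [Matrix.det_succ_row_zero, Fin.sum_univ_succ, Fin.succAbove]
  ring
end

section
/- Let r, b, ρ1, ρ2 be real numbers with −1 < ρ1 < 1 and −1 < ρ2 < 1, Σm = [[1, r],[r, 1]], Σc = [[ρ1, b],[b, ρ2]], and let Σ be the 4×4 block matrix [[Σm, Σc],[Σc, Σm]]. Then Σ is positive definite if and only if |b − r| < √((1 − ρ1)(1 − ρ2)) and |b + r| < √((1 + ρ1)(1 + ρ2)). -/
open Matrix

lemma form_pos (a c d u v : ℝ) (ha : 0 < a) (h : c ^ 2 < a * d) (huv : u ≠ 0 ∨ v ≠ 0) :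
    0 < a * u ^ 2 + 2 * c * u * v + d * v ^ 2 := by
  have e : a * (a * u ^ 2 + 2 * c * u * v + d * v ^ 2)
      = (a * u + c * v) ^ 2 + (a * d - c ^ 2) * v ^ 2 := by ring
  refine pos_of_mul_pos_right (a := a) ?_ ha.le
  rw [e]
  by_cases hv : v = 0
  · have hu : u ≠ 0 := by tauto
    subst hv
    simp only [mul_zero, add_zero]
    positivity
  · have : 0 < a * d - c ^ 2 := by linarith
    positivity

lemma form_nonneg (a c d u v : ℝ) (ha : 0 < a) (h : c ^ 2 < a * d) :
    0 ≤ a * u ^ 2 + 2 * c * u * v + d * v ^ 2 := by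
  by_cases huv : u ≠ 0 ∨ v ≠ 0
  · exact (form_pos a c d u v ha h huv).le
  · push Not at huv
    simp [huv.1, huv.2]

/-- Positive-definiteness conditions for the 4×4 supermatrix
`Σ = [[Σm, Σc],[Σc, Σm]]` with `Σm = [[1,r],[r,1]]`, `Σc = [[ρ1,b],[b,ρ2]]`. -/
theorem stmt_6 (r b ρ1 ρ2 : ℝ)
    (h1 : -1 < ρ1) (h1' : ρ1 < 1) (h2 : -1 < ρ2) (h2' : ρ2 < 1) :
    (Matrix.fromBlocks (!![1, r; r, 1]) (!![ρ1, b; b, ρ2])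
        (!![ρ1, b; b, ρ2]) (!![1, r; r, 1])).PosDef ↔
      |b - r| < Real.sqrt ((1 - ρ1) * (1 - ρ2)) ∧
      |b + r| < Real.sqrt ((1 + ρ1) * (1 + ρ2)) := by
  have key : ∀ x : Fin 2 ⊕ Fin 2 → ℝ,
      star x ⬝ᵥ ((Matrix.fromBlocks (!![1, r; r, 1]) (!![ρ1, b; b, ρ2])
        (!![ρ1, b; b, ρ2]) (!![1, r; r, 1])) *ᵥ x) =
      1 / 2 * (((1 + ρ1) * (x (.inl 0) + x (.inr 0)) ^ 2
          + 2 * (b + r) * (x (.inl 0) + x (.inr 0)) * (x (.inl 1) + x (.inr 1))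
          + (1 + ρ2) * (x (.inl 1) + x (.inr 1)) ^ 2)
        + ((1 - ρ1) * (x (.inl 0) - x (.inr 0)) ^ 2
          + 2 * (r - b) * (x (.inl 0) - x (.inr 0)) * (x (.inl 1) - x (.inr 1))
          + (1 - ρ2) * (x (.inl 1) - x (.inr 1)) ^ 2)) := by
    intro x
    simp [dotProduct, mulVec, Fintype.sum_sum_type, Fin.sum_univ_two]
    ring
  rw [Real.lt_sqrt (abs_nonneg _), Real.lt_sqrt (abs_nonneg _), sq_abs, sq_abs,
    posDef_iff_dotProduct_mulVec]
  constructor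
  · rintro ⟨-, h⟩
    constructor
    · have := @h (Sum.elim ![1 - ρ2, b - r] ![-(1 - ρ2), -(b - r)]) (by
        intro h0
        have := congrFun h0 (.inl 0)
        simp at this
        linarith)
      rw [key] at this
      simp at this
      have hp : 0 < (1 - ρ2) * ((1 - ρ1) * (1 - ρ2) - (b - r) ^ 2) := by nlinarith
      have := pos_of_mul_pos_right hp (by linarith)
      linarith
    · have := @h (Sum.elim ![1 + ρ2, -(b + r)] ![1 + ρ2, -(b + r)]) (by
        intro h0
        have := congrFun h0 (.inl 0)
        simp at this
        linarith)
      rw [key] at this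
      simp at this
      have hp : 0 < (1 + ρ2) * ((1 + ρ1) * (1 + ρ2) - (b + r) ^ 2) := by nlinarith
      have := pos_of_mul_pos_right hp (by linarith)
      linarith
  · rintro ⟨hm, hp⟩
    have hm' : (r - b) ^ 2 < (1 - ρ1) * (1 - ρ2) := by nlinarith
    refine ⟨?_, ?_⟩
    · ext i j
      rcases i with i | i <;> rcases j with j | j <;> fin_cases i <;> fin_cases j <;> simp
    · intro x hx
      rw [key]
      have a1 : 0 < 1 + ρ1 := by linarith
      have a2 : 0 < 1 - ρ1 := by linarith
      have n1 := form_nonneg _ _ _ (x (.inl 0) + x (.inr 0)) (x (.inl 1) + x (.inr 1)) a1 hp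
      have n2 := form_nonneg _ _ _ (x (.inl 0) - x (.inr 0)) (x (.inl 1) - x (.inr 1)) a2 hm'
      by_cases c1 : x (.inl 0) + x (.inr 0) ≠ 0 ∨ x (.inl 1) + x (.inr 1) ≠ 0
      · have := form_pos _ _ _ _ _ a1 hp c1
        linarith
      by_cases c2 : x (.inl 0) - x (.inr 0) ≠ 0 ∨ x (.inl 1) - x (.inr 1) ≠ 0
      · have := form_pos _ _ _ _ _ a2 hm' c2
        linarith
      push Not at c1 c2
      exfalso
      apply hx
      obtain ⟨c3, c4⟩ := c1
      obtain ⟨c5, c6⟩ := c2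
      ext i
      rcases i with i | i <;> fin_cases i <;> simp <;> linarith
end

section
/- Let r, b, ρ1, ρ2 be real numbers with −1 < ρ1 < 1, −1 < ρ2 < 1, |b − r| < √((1 − ρ1)(1 − ρ2)), and |b + r| < √((1 + ρ1)(1 + ρ2)) (so that the 4×4 supermatrix Σ = [[Σm, Σc],[Σc, Σm]] with Σm = [[1, r],[r, 1]] and Σc = [[ρ1, b],[b, ρ2]] is positive definite). Then the canonical correlation ρ_c = sup over nonzero w_i, w_j ∈ ℝ² of |w_iᵀ Σc w_j| / (√(w_iᵀ Σm w_i)·√(w_jᵀ Σm w_j)) is given explicitly by ρ_c = max{ |(ρ1 + ρ2 − 2br − √D)/(2(1 − r²))| , |(ρ1 + ρ2 − 2br + √D)/(2(1 − r²))| }, where D = (ρ1 − ρ2)² + 4(b − ρ1·r)(b − ρ2·r). -/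
open Matrix

lemma aux_psd (A B C x y : ℝ) (hA : 0 ≤ A) (hC : 0 ≤ C) (h : A * C = B ^ 2) :
    0 ≤ A * x ^ 2 + 2 * B * (x * y) + C * y ^ 2 := by
  rcases hA.eq_or_lt with h0 | h0
  · have hB : B = 0 := by
      have : B ^ 2 = 0 := by rw [← h, ← h0]; ring
      exact pow_eq_zero_iff (two_ne_zero) |>.1 this
    rw [← h0, hB]
    have := mul_nonneg hC (sq_nonneg y)
    linarith
  · have h3 : A * (A * x ^ 2 + 2 * B * (x * y) + C * y ^ 2) = (A * x + B * y) ^ 2 := by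
      linear_combination y ^ 2 * h
    by_contra hn
    push Not at hn
    have := mul_neg_of_pos_of_neg h0 hn
    nlinarith [sq_nonneg (A * x + B * y)]

/-- The main result in terms of the two generalized eigenvalues. -/
lemma aux_main (r b ρ1 ρ2 L U : ℝ) (hr : 0 < 1 - r ^ 2) (hLU : L ≤ U)
    (hs : (1 - r ^ 2) * (L + U) = ρ1 + ρ2 - 2 * b * r)
    (hp : (1 - r ^ 2) * (L * U) = ρ1 * ρ2 - b ^ 2) :
    sSup {x : ℝ | ∃ wi wj : Fin 2 → ℝ, wi ≠ 0 ∧ wj ≠ 0 ∧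
        x = |wi ⬝ᵥ ((!![ρ1, b; b, ρ2] : Matrix (Fin 2) (Fin 2) ℝ) *ᵥ wj)| /
          (Real.sqrt (wi ⬝ᵥ ((!![1, r; r, 1] : Matrix (Fin 2) (Fin 2) ℝ) *ᵥ wi)) *
           Real.sqrt (wj ⬝ᵥ ((!![1, r; r, 1] : Matrix (Fin 2) (Fin 2) ℝ) *ᵥ wj)))} =
      max |L| |U| := by
  have hb : ∀ ρ : ℝ, (1 - r ^ 2) * ((ρ - L) * (ρ - U)) ≤ 0 → L ≤ ρ ∧ ρ ≤ U := by
    intro ρ h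
    have h' : (ρ - L) * (ρ - U) ≤ 0 := by
      by_contra hn
      push Not at hn
      have := mul_pos hr hn
      linarith
    constructor
    · by_contra hn
      push Not at hn
      nlinarith [mul_pos (sub_pos.2 hn) (sub_pos.2 (lt_of_lt_of_le hn hLU))]
    · by_contra hn
      push Not at hn
      nlinarith [mul_pos (sub_pos.2 hn) (sub_pos.2 (lt_of_le_of_lt hLU hn))]
  obtain ⟨hL1, hU1⟩ := hb ρ1 (by
    have : (1 - r ^ 2) * ((ρ1 - L) * (ρ1 - U)) = -(b - ρ1 * r) ^ 2 := by
      linear_combination hp - ρ1 * hs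
    rw [this]; nlinarith [sq_nonneg (b - ρ1 * r)])
  obtain ⟨hL2, hU2⟩ := hb ρ2 (by
    have : (1 - r ^ 2) * ((ρ2 - L) * (ρ2 - U)) = -(b - ρ2 * r) ^ 2 := by
      linear_combination hp - ρ2 * hs
    rw [this]; nlinarith [sq_nonneg (b - ρ2 * r)])
  set M := max |L| |U| with hM
  have hUM : U ≤ M := (le_abs_self U).trans (le_max_right _ _)
  have hLM : -M ≤ L := by
    have := (neg_abs_le L); have h2 : |L| ≤ M := le_max_left _ _
    linarith
  have hpos : ∀ x y : ℝ, 0 ≤ x ^ 2 + 2 * r * (x * y) + y ^ 2 := by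
    intro x y
    nlinarith [sq_nonneg (x + r * y), mul_nonneg hr.le (sq_nonneg y)]
  have hup : ∀ x y : ℝ, ρ1 * x ^ 2 + 2 * b * (x * y) + ρ2 * y ^ 2 ≤
      M * (x ^ 2 + 2 * r * (x * y) + y ^ 2) := by
    intro x y
    have h := aux_psd (U - ρ1) (U * r - b) (U - ρ2) x y (by linarith) (by linarith)
      (by linear_combination U * hs - hp)
    have := mul_le_mul_of_nonneg_right hUM (hpos x y)
    linarith
  have hlo : ∀ x y : ℝ, -(M * (x ^ 2 + 2 * r * (x * y) + y ^ 2)) ≤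
      ρ1 * x ^ 2 + 2 * b * (x * y) + ρ2 * y ^ 2 := by
    intro x y
    have h := aux_psd (ρ1 - L) (b - L * r) (ρ2 - L) x y (by linarith) (by linarith)
      (by linear_combination L * hs - hp)
    have := mul_le_mul_of_nonneg_right hLM (hpos x y)
    linarith
  have hform : ∀ p c q d : ℝ, ∀ v w : Fin 2 → ℝ,
      v ⬝ᵥ ((!![p, c; d, q] : Matrix (Fin 2) (Fin 2) ℝ) *ᵥ w) =
      v 0 * (p * w 0 + c * w 1) + v 1 * (d * w 0 + q * w 1) := by
    intro p c q d v w
    simp [dotProduct, mulVec, Fin.sum_univ_two]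
  have hposv : ∀ w : Fin 2 → ℝ, w ≠ 0 →
      0 < w ⬝ᵥ ((!![1, r; r, 1] : Matrix (Fin 2) (Fin 2) ℝ) *ᵥ w) := by
    intro w hw
    rw [hform]
    by_contra hn
    push Not at hn
    apply hw
    have e1 : w 1 = 0 := by
      have : (1 - r ^ 2) * w 1 ^ 2 ≤ 0 := by nlinarith [sq_nonneg (w 0 + r * w 1)]
      by_contra h
      have := mul_pos hr (pow_pos (abs_pos.2 h) 2)
      rw [sq_abs] at this
      linarith
    have e0 : w 0 = 0 := by
      rw [e1] at hn
      have : w 0 ^ 2 = 0 := le_antisymm (by linarith) (sq_nonneg _)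
      exact pow_eq_zero_iff (two_ne_zero) |>.1 this
    ext i
    fin_cases i
    · simpa using e0
    · simpa using e1
  have heig : ∀ l : ℝ, (1 - r ^ 2) * ((l - L) * (l - U)) = 0 →
      ∃ wi wj : Fin 2 → ℝ, wi ≠ 0 ∧ wj ≠ 0 ∧
        |l| = |wi ⬝ᵥ ((!![ρ1, b; b, ρ2] : Matrix (Fin 2) (Fin 2) ℝ) *ᵥ wj)| /
          (Real.sqrt (wi ⬝ᵥ ((!![1, r; r, 1] : Matrix (Fin 2) (Fin 2) ℝ) *ᵥ wi)) *
           Real.sqrt (wj ⬝ᵥ ((!![1, r; r, 1] : Matrix (Fin 2) (Fin 2) ℝ) *ᵥ wj))) := by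
    intro l hl
    obtain ⟨w, hw, hz⟩ := (Matrix.exists_mulVec_eq_zero_iff
      (M := (!![ρ1 - l, b - l * r; b - l * r, ρ2 - l] : Matrix (Fin 2) (Fin 2) ℝ))).2 (by
        rw [Matrix.det_fin_two_of]
        linear_combination hl + l * hs - hp)
    refine ⟨w, w, hw, hw, ?_⟩
    have hp := hposv w hw
    have key : w ⬝ᵥ ((!![ρ1, b; b, ρ2] : Matrix (Fin 2) (Fin 2) ℝ) *ᵥ w) =
        l * (w ⬝ᵥ ((!![1, r; r, 1] : Matrix (Fin 2) (Fin 2) ℝ) *ᵥ w)) := by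
      have h := congrArg (fun u => w ⬝ᵥ u) hz
      simp only [hform, dotProduct_zero] at h ⊢
      linear_combination h
    rw [key, Real.mul_self_sqrt hp.le, abs_mul, abs_of_pos hp, mul_div_assoc, div_self hp.ne',
      mul_one]
  apply IsLUB.csSup_eq
  · constructor
    · rintro x ⟨v, w, hv, hw, rfl⟩
      have pv := hposv v hv
      have pw := hposv w hw
      have sv := Real.sqrt_pos.2 pv
      have sw := Real.sqrt_pos.2 pw
      have qv := Real.sq_sqrt pv.le
      have qw := Real.sq_sqrt pw.le
      set s := Real.sqrt (v ⬝ᵥ ((!![1, r; r, 1] : Matrix (Fin 2) (Fin 2) ℝ) *ᵥ v))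
      set t := Real.sqrt (w ⬝ᵥ ((!![1, r; r, 1] : Matrix (Fin 2) (Fin 2) ℝ) *ᵥ w))
      rw [div_le_iff₀ (mul_pos sv sw)]
      rw [hform] at qv qw ⊢
      have a1 := hup (t * v 0 + s * w 0) (t * v 1 + s * w 1)
      have a2 := hlo (t * v 0 + s * w 0) (t * v 1 + s * w 1)
      have a3 := hup (t * v 0 - s * w 0) (t * v 1 - s * w 1)
      have a4 := hlo (t * v 0 - s * w 0) (t * v 1 - s * w 1)
      have e : M * ((t * v 0 + s * w 0) ^ 2 + 2 * r * ((t * v 0 + s * w 0) * (t * v 1 + s * w 1)) + (t * v 1 + s * w 1) ^ 2)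
         + M * ((t * v 0 - s * w 0) ^ 2 + 2 * r * ((t * v 0 - s * w 0) * (t * v 1 - s * w 1)) + (t * v 1 - s * w 1) ^ 2)
         = 4 * (s * t) * (M * (s * t)) := by
        linear_combination (-2 * M * t ^ 2) * qv - 2 * M * s ^ 2 * qw
      have e2 : (ρ1 * (t * v 0 + s * w 0) ^ 2 + 2 * b * ((t * v 0 + s * w 0) * (t * v 1 + s * w 1)) + ρ2 * (t * v 1 + s * w 1) ^ 2)
         - (ρ1 * (t * v 0 - s * w 0) ^ 2 + 2 * b * ((t * v 0 - s * w 0) * (t * v 1 - s * w 1)) + ρ2 * (t * v 1 - s * w 1) ^ 2)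
         = 4 * (s * t) * (v 0 * (ρ1 * w 0 + b * w 1) + v 1 * (b * w 0 + ρ2 * w 1)) := by
        ring
      have hst : 0 < 4 * (s * t) := by positivity
      rw [abs_le]
      constructor
      · refine le_of_mul_le_mul_left ?_ hst
        linarith
      · refine le_of_mul_le_mul_left ?_ hst
        linarith
    · intro B hB
      exact max_le (hB (heig L (by ring))) (hB (heig U (by ring)))
  · exact ⟨_, heig L (by ring)⟩

/-- Explicit formula for the canonical correlation in the homogeneous
two-attribute case. -/
theorem stmt_8 (r b ρ1 ρ2 : ℝ)
    (h1 : -1 < ρ1) (h1' : ρ1 < 1) (h2 : -1 < ρ2) (h2' : ρ2 < 1)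
    (hbr : |b - r| < Real.sqrt ((1 - ρ1) * (1 - ρ2)))
    (hbr' : |b + r| < Real.sqrt ((1 + ρ1) * (1 + ρ2))) :
    sSup {x : ℝ | ∃ wi wj : Fin 2 → ℝ, wi ≠ 0 ∧ wj ≠ 0 ∧
        x = |wi ⬝ᵥ ((!![ρ1, b; b, ρ2] : Matrix (Fin 2) (Fin 2) ℝ) *ᵥ wj)| /
          (Real.sqrt (wi ⬝ᵥ ((!![1, r; r, 1] : Matrix (Fin 2) (Fin 2) ℝ) *ᵥ wi)) *
           Real.sqrt (wj ⬝ᵥ ((!![1, r; r, 1] : Matrix (Fin 2) (Fin 2) ℝ) *ᵥ wj)))} =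
      max
        |(ρ1 + ρ2 - 2 * b * r -
            Real.sqrt ((ρ1 - ρ2) ^ 2 + 4 * (b - ρ1 * r) * (b - ρ2 * r))) / (2 * (1 - r ^ 2))|
        |(ρ1 + ρ2 - 2 * b * r +
            Real.sqrt ((ρ1 - ρ2) ^ 2 + 4 * (b - ρ1 * r) * (b - ρ2 * r))) / (2 * (1 - r ^ 2))| := by
  have hr : 0 < 1 - r ^ 2 := by
    have k1 : Real.sqrt ((1 - ρ1) * (1 - ρ2)) ≤ ((1 - ρ1) + (1 - ρ2)) / 2 := by
      apply Real.sqrt_le_iff.2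
      constructor
      · linarith
      · nlinarith [sq_nonneg (ρ1 - ρ2)]
    have k2 : Real.sqrt ((1 + ρ1) * (1 + ρ2)) ≤ ((1 + ρ1) + (1 + ρ2)) / 2 := by
      apply Real.sqrt_le_iff.2
      constructor
      · linarith
      · nlinarith [sq_nonneg (ρ1 - ρ2)]
    have l1 := abs_lt.1 hbr
    have l2 := abs_lt.1 hbr'
    have m1 : r < 1 := by linarith [l1.1, l2.2]
    have m2 : -1 < r := by linarith [l1.2, l2.1]
    nlinarith [mul_pos (sub_pos.2 m1) (sub_pos.2 m2)]
  have hD : 0 ≤ (ρ1 - ρ2) ^ 2 + 4 * (b - ρ1 * r) * (b - ρ2 * r) := by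
    nlinarith [mul_nonneg hr.le (sq_nonneg (ρ1 - ρ2)), sq_nonneg (2 * b - r * (ρ1 + ρ2))]
  have hsq := Real.sq_sqrt hD
  have hnn := Real.sqrt_nonneg ((ρ1 - ρ2) ^ 2 + 4 * (b - ρ1 * r) * (b - ρ2 * r))
  set S := Real.sqrt ((ρ1 - ρ2) ^ 2 + 4 * (b - ρ1 * r) * (b - ρ2 * r))
  apply aux_main r b ρ1 ρ2 _ _ hr
  · apply div_le_div_of_nonneg_right _ (by linarith)
    linarith
  · have := hr.ne'
    field_simp
    ring
  · have := hr.ne'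
    field_simp
    linear_combination -hsq
end

section
/- Let k ≥ 2 be an integer and r, b, ρ real numbers with −1/(k−1) < r < 1, |ρ − b| < |1 − r|, and |ρ + (k−1)b| < |1 + (k−1)r|. With J_k the k×k all-ones matrix, Σm = (1 − r)·I_k + r·J_k, and Σc = (ρ − b)·I_k + b·J_k, the canonical correlation ρ_c = sup over nonzero w_i, w_j ∈ ℝ^k of |w_iᵀ Σc w_j| / (√(w_iᵀ Σm w_i)·√(w_jᵀ Σm w_j)) is given explicitly by ρ_c = max{ |(ρ − b)/(1 − r)| , |(ρ + (k−1)b)/(1 + (k−1)r)| }. -/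
open Matrix

lemma form_eq (k : ℕ) (a c : ℝ) (u v : Fin k → ℝ) :
    u ⬝ᵥ ((a • (1 : Matrix (Fin k) (Fin k) ℝ) + c • Matrix.of (fun _ _ => (1 : ℝ))) *ᵥ v)
      = a * (∑ i, u i * v i) + c * ((∑ i, u i) * ∑ i, v i) := by
  have h : (Matrix.of (fun _ _ => (1 : ℝ)) : Matrix (Fin k) (Fin k) ℝ) *ᵥ v
      = fun _ => ∑ i, v i := by
    ext i
    simp [Matrix.mulVec, dotProduct]
  rw [Matrix.add_mulVec, Matrix.smul_mulVec, Matrix.smul_mulVec, Matrix.one_mulVec, h,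
    dotProduct_add, dotProduct_smul, dotProduct_smul]
  simp only [dotProduct, smul_eq_mul, Finset.sum_mul]

lemma centered (k : ℕ) (hk : (k : ℝ) ≠ 0) (u v : Fin k → ℝ) :
    ∑ i, u i * v i = (∑ i, (u i - (∑ j, u j) / k) * (v i - (∑ j, v j) / k))
      + (∑ i, u i) * (∑ i, v i) / k := by
  have : ∀ i, (u i - (∑ j, u j) / k) * (v i - (∑ j, v j) / k) =
      u i * v i - u i * ((∑ j, v j) / k) - ((∑ j, u j) / k) * v i
        + ((∑ j, u j) / k) * ((∑ j, v j) / k) := fun i => by ring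
  simp only [this, Finset.sum_add_distrib, Finset.sum_sub_distrib, ← Finset.sum_mul,
    ← Finset.mul_sum, Finset.sum_const, Finset.card_univ, Fintype.card_fin, nsmul_eq_mul]
  field_simp
  ring

lemma upper (k α β p q M D A B s t : ℝ) (hk : 0 < k) (hα : 0 < α) (hβ : 0 < β)
    (hp : |p| ≤ M * α) (hq : |q| ≤ M * β) (hM : 0 ≤ M) (hA : 0 ≤ A) (hB : 0 ≤ B)
    (hD : D ^ 2 ≤ A * B) :
    |p * D + q * (s * t / k)| ≤
      M * (√(α * A + β * (s * s / k)) * √(α * B + β * (t * t / k))) := by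
  have hD' : |D| ≤ √A * √B := by
    rw [← Real.sqrt_mul hA]
    exact Real.abs_le_sqrt hD
  have hs : 0 ≤ s * s / k := div_nonneg (mul_self_nonneg s) hk.le
  have ht : 0 ≤ t * t / k := div_nonneg (mul_self_nonneg t) hk.le
  have key : α * (√A * √B) + β * |s * t / k| ≤
      √(α * A + β * (s * s / k)) * √(α * B + β * (t * t / k)) := by
    rw [← Real.sqrt_mul (show 0 ≤ α * A + β * (s * s / k) by positivity)]
    apply Real.le_sqrt_of_sq_le
    have e1 : |s * t / k| = √(s * s / k) * √(t * t / k) := by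
      rw [← Real.sqrt_mul hs, ← Real.sqrt_sq_eq_abs]
      congr 1
      ring
    rw [e1]
    have a1 := Real.sq_sqrt hA
    have a2 := Real.sq_sqrt hB
    have a3 := Real.sq_sqrt hs
    have a4 := Real.sq_sqrt ht
    generalize √A = x at *
    generalize √B = y at *
    generalize √(s * s / k) = z at *
    generalize √(t * t / k) = w at *
    rw [← a1, ← a2, ← a3, ← a4]
    nlinarith [mul_nonneg (mul_nonneg hα.le hβ.le) (sq_nonneg (x * w - y * z))]
  calc |p * D + q * (s * t / k)| ≤ |p| * |D| + |q| * |s * t / k| := by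
        rw [← abs_mul, ← abs_mul]; exact abs_add_le _ _
    _ ≤ (M * α) * (√A * √B) + (M * β) * |s * t / k| := by gcongr
    _ = M * (α * (√A * √B) + β * |s * t / k|) := by ring
    _ ≤ _ := by gcongr

/-- Explicit formula for the canonical correlation in the equicorrelated
homogeneous case with `k` attributes per node. -/
theorem stmt_12 (k : ℕ) (hk : 2 ≤ k) (r b ρ : ℝ)
    (hr : -1 / ((k : ℝ) - 1) < r) (hr' : r < 1)
    (h1 : |ρ - b| < |1 - r|)
    (h2 : |ρ + ((k : ℝ) - 1) * b| < |1 + ((k : ℝ) - 1) * r|) :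
    sSup {x : ℝ | ∃ wi wj : Fin k → ℝ, wi ≠ 0 ∧ wj ≠ 0 ∧
        x = |wi ⬝ᵥ (((ρ - b) • (1 : Matrix (Fin k) (Fin k) ℝ)
              + b • Matrix.of (fun _ _ => (1 : ℝ))) *ᵥ wj)| /
          (Real.sqrt (wi ⬝ᵥ (((1 - r) • (1 : Matrix (Fin k) (Fin k) ℝ)
              + r • Matrix.of (fun _ _ => (1 : ℝ))) *ᵥ wi)) *
           Real.sqrt (wj ⬝ᵥ (((1 - r) • (1 : Matrix (Fin k) (Fin k) ℝ)
              + r • Matrix.of (fun _ _ => (1 : ℝ))) *ᵥ wj)))} =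
      max |(ρ - b) / (1 - r)|
        |(ρ + ((k : ℝ) - 1) * b) / (1 + ((k : ℝ) - 1) * r)| := by
  have hk2 : (2 : ℝ) ≤ k := by exact_mod_cast hk
  have hk0 : (0 : ℝ) < k := by linarith
  have hα : 0 < 1 - r := by linarith
  have hβ : 0 < 1 + ((k : ℝ) - 1) * r := by
    rw [div_lt_iff₀ (by linarith)] at hr
    linarith
  simp only [form_eq]
  apply IsLUB.csSup_eq
  swap
  · exact ⟨_, fun _ => 1, fun _ => 1, fun h => by simpa using congrFun h ⟨0, by omega⟩,
      fun h => by simpa using congrFun h ⟨0, by omega⟩, rfl⟩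
  apply IsGreatest.isLUB
  constructor
  · rcases max_choice |(ρ - b) / (1 - r)|
        |(ρ + ((k : ℝ) - 1) * b) / (1 + ((k : ℝ) - 1) * r)| with h | h <;> rw [h]
    · let i0 : Fin k := ⟨0, by omega⟩
      let i1 : Fin k := ⟨1, by omega⟩
      have hne : i0 ≠ i1 := by simp [i0, i1]
      let w : Fin k → ℝ := Pi.single i0 1 - Pi.single i1 1
      have hw : w ≠ 0 := fun h => by
        have := congrFun h i0
        simp [w, hne] at this
      have hS : ∑ i, w i = 0 := by simp [w, Finset.sum_sub_distrib]
      have hQ : ∑ i, w i * w i = 2 := by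
        have : ∀ i, w i * w i = (Pi.single i0 1 : Fin k → ℝ) i + (Pi.single i1 1 : Fin k → ℝ) i := by
          intro i
          by_cases h0 : i = i0
          · subst h0; simp [w, hne]
          · by_cases h1 : i = i1
            · subst h1; simp [w, hne.symm]
            · simp [w, h0, h1]
        simp only [this, Finset.sum_add_distrib]
        simp
        norm_num
      refine ⟨w, w, hw, hw, ?_⟩
      rw [hS, hQ, Real.mul_self_sqrt (by nlinarith)]
      simp only [mul_zero, add_zero]
      rw [abs_div, abs_mul, abs_of_pos hα, abs_two]
      field_simp
    · refine ⟨fun _ => 1, fun _ => 1, fun h => by simpa using congrFun h ⟨0, by omega⟩,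
        fun h => by simpa using congrFun h ⟨0, by omega⟩, ?_⟩
      have e : ∀ a c : ℝ, a * (∑ _i : Fin k, (1 : ℝ) * 1)
          + c * ((∑ _i : Fin k, (1 : ℝ)) * ∑ _i : Fin k, (1 : ℝ)) = k * (a + k * c) := by
        intro a c
        simp
        ring
      rw [e, e]
      have e1 : 1 - r + k * r = 1 + ((k : ℝ) - 1) * r := by ring
      have e2 : ρ - b + k * b = ρ + ((k : ℝ) - 1) * b := by ring
      rw [e1, e2, Real.mul_self_sqrt (by positivity), abs_mul, abs_div, abs_of_pos hk0,
        abs_of_pos hβ, mul_div_mul_left _ _ hk0.ne']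
  · rintro x ⟨u, v, -, -, rfl⟩
    set M := max |(ρ - b) / (1 - r)|
        |(ρ + ((k : ℝ) - 1) * b) / (1 + ((k : ℝ) - 1) * r)| with hMdef
    have hM : 0 ≤ M := le_max_of_le_left (abs_nonneg _)
    have hp : |ρ - b| ≤ M * (1 - r) := by
      rw [← div_le_iff₀ hα]
      calc _ = |(ρ - b) / (1 - r)| := by rw [abs_div, abs_of_pos hα]
        _ ≤ M := le_max_left _ _
    have hq : |ρ + ((k : ℝ) - 1) * b| ≤ M * (1 + ((k : ℝ) - 1) * r) := by
      rw [← div_le_iff₀ hβ]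
      calc _ = |(ρ + ((k : ℝ) - 1) * b) / (1 + ((k : ℝ) - 1) * r)| := by
            rw [abs_div, abs_of_pos hβ]
        _ ≤ M := le_max_right _ _
    apply div_le_of_le_mul₀ (by positivity) hM
    have split : ∀ (a c : ℝ) (u v : Fin k → ℝ),
        (a - c) * (∑ i, u i * v i) + c * ((∑ i, u i) * ∑ i, v i) =
        (a - c) * (∑ i, (u i - (∑ j, u j) / k) * (v i - (∑ j, v j) / k))
          + (a + ((k : ℝ) - 1) * c) * ((∑ i, u i) * (∑ i, v i) / k) := by
      intro a c u v
      rw [centered k hk0.ne' u v]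
      generalize (∑ i, (u i - (∑ j, u j) / k) * (v i - (∑ j, v j) / k)) = D
      field_simp
      ring
    rw [split, split, split]
    refine upper k _ _ _ _ M _ _ _ _ _ hk0 hα hβ hp hq hM
      (Finset.sum_nonneg fun i _ => mul_self_nonneg _)
      (Finset.sum_nonneg fun i _ => mul_self_nonneg _) ?_
    have := Finset.sum_mul_sq_le_sq_mul_sq Finset.univ
      (fun i => u i - (∑ j, u j) / k) (fun i => v i - (∑ j, v j) / k)
    simpa only [sq] using this
end
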